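/- Let (A, Δ, r) be a pseudo-Hessian pre-Lie coalgebra over a field K with r = Σᵢ aᵢ⊗bᵢ ∈ A⊗A symmetric, and let ω ∈ (A⊗A)* be a symmetric solution of the co-S-equation in (A, Δ), with induced pre-Lie product x ∘_ω y := x₍₁₎ ω(x₍₂₎, y) + y₍₁₎ ω(x, y₍₂₎) − ω(x, y₍₁₎) y₍₂₎. Assume moreover that r is a solution of the S-equation in the pre-Lie algebra (A, ∘_ω). Then the linear map S : A → A defined by S(x) = Σᵢ aᵢ ω(bᵢ, x) makes ((A, Δ), S) a Nijenhuis pre-Lie coalgebra, i.e., S(x₍₁₎)⊗S(x₍₂₎) + S²(x)₍₁₎⊗S²(x)₍₂₎ = S(S(x)₍₁₎)⊗S(x)₍₂₎ + S(x)₍₁₎⊗S(S(x)₍₂₎) for all x ∈ A. -/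

import Mathlib

open TensorProduct LinearMap

noncomputable section

section Defs

variable (K A : Type*) [Field K] [AddCommGroup A] [Module K A]

/-- The flip map on `A ⊗ A`. -/
def flipT : A ⊗[K] A →ₗ[K] A ⊗[K] A := (TensorProduct.comm K A A).toLinearMap

/-- Swap the first two tensor factors of `A ⊗ (A ⊗ A)`. -/
def swap12 : A ⊗[K] (A ⊗[K] A) →ₗ[K] A ⊗[K] (A ⊗[K] A) :=
  (TensorProduct.assoc K A A A).toLinearMap ∘ₗ
    (TensorProduct.map (flipT K A) LinearMap.id) ∘ₗ
      (TensorProduct.assoc K A A A).symm.toLinearMap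

/-- Cyclic permutation `a ⊗ b ⊗ c ↦ c ⊗ a ⊗ b` on `A ⊗ (A ⊗ A)`. -/
def cyc : A ⊗[K] (A ⊗[K] A) →ₗ[K] A ⊗[K] (A ⊗[K] A) :=
  (TensorProduct.comm K (A ⊗[K] A) A).toLinearMap ∘ₗ
    (TensorProduct.assoc K A A A).symm.toLinearMap

variable {K A}

/-- `coassoc1 Δ δ x = x₍₁₎₍₁'₎ ⊗ x₍₁₎₍₂'₎ ⊗ x₍₂₎`, applying `δ` to the first Sweedler leg of `Δ`. -/
def coassoc1 (Δ δ : A →ₗ[K] A ⊗[K] A) : A →ₗ[K] A ⊗[K] (A ⊗[K] A) :=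
  (TensorProduct.assoc K A A A).toLinearMap ∘ₗ (TensorProduct.map δ LinearMap.id) ∘ₗ Δ

/-- `coassoc2 Δ δ x = x₍₁₎ ⊗ x₍₂₎₍₁'₎ ⊗ x₍₂₎₍₂'₎`, applying `δ` to the second Sweedler leg of `Δ`. -/
def coassoc2 (Δ δ : A →ₗ[K] A ⊗[K] A) : A →ₗ[K] A ⊗[K] (A ⊗[K] A) :=
  (TensorProduct.map LinearMap.id δ) ∘ₗ Δ

/-- The (left) pre-Lie identity for a bilinear multiplication. -/
def IsPreLie (m : A →ₗ[K] A →ₗ[K] A) : Prop :=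
  ∀ x y z : A, m (m x y) z - m x (m y z) = m (m y x) z - m y (m x z)

/-- The pre-Lie coalgebra identity for a comultiplication. -/
def IsPreLieCo (Δ : A →ₗ[K] A ⊗[K] A) : Prop :=
  ∀ x : A, coassoc1 Δ Δ x - coassoc2 Δ Δ x
    = swap12 K A (coassoc1 Δ Δ x) - swap12 K A (coassoc2 Δ Δ x)

/-- Equation (2.2) of a pre-Lie bialgebra. -/
def BialgEq1 (m : A →ₗ[K] A →ₗ[K] A) (Δ : A →ₗ[K] A ⊗[K] A) : Prop :=
  ∀ x y : A, Δ (m x y) - Δ (m y x)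
    = rTensor A (m x) (Δ y) + lTensor A (m x) (Δ y) - lTensor A (m.flip x) (Δ y)
      - rTensor A (m y) (Δ x) - lTensor A (m y) (Δ x) + lTensor A (m.flip y) (Δ x)

/-- Equation (2.3) of a pre-Lie bialgebra. -/
def BialgEq2 (m : A →ₗ[K] A →ₗ[K] A) (Δ : A →ₗ[K] A ⊗[K] A) : Prop :=
  ∀ x y : A, Δ (m x y) - flipT K A (Δ (m x y))
    = lTensor A (m.flip y) (Δ x) + lTensor A (m x) (Δ y)
      - flipT K A (rTensor A (m x) (Δ y)) - flipT K A (lTensor A (m.flip y) (Δ x))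
      - flipT K A (lTensor A (m x) (Δ y)) + rTensor A (m x) (Δ y)

/-- `(A, m, Δ)` is a pre-Lie bialgebra. -/
def IsPreLieBialg (m : A →ₗ[K] A →ₗ[K] A) (Δ : A →ₗ[K] A ⊗[K] A) : Prop :=
  IsPreLie m ∧ IsPreLieCo Δ ∧ BialgEq1 m Δ ∧ BialgEq2 m Δ

/-- The linear form on `A ⊗ A` given by `u ⊗ v ↦ f u * g v`. -/
def pairForm (f g : A →ₗ[K] K) : A ⊗[K] A →ₗ[K] K :=
  TensorProduct.lift ((LinearMap.mul K K).compl₁₂ f g)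

/-- The co-S-equation for a bilinear form `ω` on a pre-Lie coalgebra `(A, Δ)`. -/
def IsCoSEq (Δ : A →ₗ[K] A ⊗[K] A) (ω : A →ₗ[K] A →ₗ[K] K) : Prop :=
  ∀ x y z : A,
    pairForm (ω x) (ω.flip z) (Δ y) + pairForm (ω x) (ω y) (Δ z)
      = pairForm (ω.flip y) (ω.flip z) (Δ x) + pairForm (ω y) (ω x) (Δ z)

/-- The multiplication `x ∘_ω y = x₍₁₎ ω(x₍₂₎, y) + y₍₁₎ ω(x, y₍₂₎) − ω(x, y₍₁₎) y₍₂₎`. -/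
def omul (Δ : A →ₗ[K] A ⊗[K] A) (ω : A →ₗ[K] A →ₗ[K] K) : A →ₗ[K] A →ₗ[K] A :=
  TensorProduct.lift ((LinearMap.smulRightₗ ∘ₗ ω).flip) ∘ₗ Δ
  + (TensorProduct.lift ((LinearMap.smulRightₗ ∘ₗ ω.flip).flip) ∘ₗ Δ).flip
  - (TensorProduct.lift (LinearMap.smulRightₗ ∘ₗ ω.flip) ∘ₗ Δ).flip

/-- `N` is a Nijenhuis operator on the (pre-)Lie algebra `(A, m)`. -/
def IsNijenhuis (m : A →ₗ[K] A →ₗ[K] A) (N : A →ₗ[K] A) : Prop :=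
  ∀ x y : A, m (N x) (N y) + N (N (m x y)) = N (m (N x) y) + N (m x (N y))

/-- `S` is a Nijenhuis operator on the (pre-)Lie coalgebra `(A, Δ)`. -/
def IsNijenhuisCo (Δ : A →ₗ[K] A ⊗[K] A) (S : A →ₗ[K] A) : Prop :=
  ∀ x : A, TensorProduct.map S S (Δ x) + Δ (S (S x))
    = rTensor A S (Δ (S x)) + lTensor A S (Δ (S x))

/-- The 2-cocycle (pseudo-Hessian) condition for a bilinear form on a pre-Lie algebra. -/
def IsHessian (m : A →ₗ[K] A →ₗ[K] A) (ω : A →ₗ[K] A →ₗ[K] K) : Prop :=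
  ∀ x y z : A, ω (m x y) z - ω x (m y z) = ω (m y x) z - ω y (m x z)

/-- The multiplication `A ⊗ A →ₗ A` induced by a bilinear multiplication. -/
def mhat (m : A →ₗ[K] A →ₗ[K] A) : A ⊗[K] A →ₗ[K] A := TensorProduct.lift m

variable (K A) in
/-- The middle-four exchange `(a ⊗ b) ⊗ (c ⊗ d) ↦ (a ⊗ c) ⊗ (b ⊗ d)` as a linear map. -/
def ttc : (A ⊗[K] A) ⊗[K] (A ⊗[K] A) →ₗ[K] (A ⊗[K] A) ⊗[K] (A ⊗[K] A) :=
  (TensorProduct.tensorTensorTensorComm K A A A A).toLinearMap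

/-- `(aᵢ ⊗ bᵢ) ⊗ (aⱼ ⊗ bⱼ) ↦ aᵢ ⊗ (bᵢ∘aⱼ) ⊗ bⱼ`. -/
def sTerm1 (m : A →ₗ[K] A →ₗ[K] A) :
    (A ⊗[K] A) ⊗[K] (A ⊗[K] A) →ₗ[K] A ⊗[K] (A ⊗[K] A) :=
  lTensor A (rTensor A (mhat m)) ∘ₗ
    lTensor A (TensorProduct.assoc K A A A).symm.toLinearMap ∘ₗ
      (TensorProduct.assoc K A A (A ⊗[K] A)).toLinearMap

/-- `(aᵢ ⊗ bᵢ) ⊗ (aⱼ ⊗ bⱼ) ↦ aᵢ ⊗ aⱼ ⊗ (bᵢ∘bⱼ)`. -/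
def sTerm2 (m : A →ₗ[K] A →ₗ[K] A) :
    (A ⊗[K] A) ⊗[K] (A ⊗[K] A) →ₗ[K] A ⊗[K] (A ⊗[K] A) :=
  lTensor A (lTensor A (mhat m) ∘ₗ swap12 K A) ∘ₗ
    (TensorProduct.assoc K A A (A ⊗[K] A)).toLinearMap

/-- `(aᵢ ⊗ bᵢ) ⊗ (aⱼ ⊗ bⱼ) ↦ (aᵢ∘aⱼ) ⊗ bᵢ ⊗ bⱼ`. -/
def sTerm3 (m : A →ₗ[K] A →ₗ[K] A) :
    (A ⊗[K] A) ⊗[K] (A ⊗[K] A) →ₗ[K] A ⊗[K] (A ⊗[K] A) :=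
  rTensor (A ⊗[K] A) (mhat m) ∘ₗ ttc K A

/-- `(aᵢ ⊗ bᵢ) ⊗ (aⱼ ⊗ bⱼ) ↦ aᵢ ⊗ aⱼ ⊗ (bⱼ∘bᵢ)`. -/
def sTerm4 (m : A →ₗ[K] A →ₗ[K] A) :
    (A ⊗[K] A) ⊗[K] (A ⊗[K] A) →ₗ[K] A ⊗[K] (A ⊗[K] A) :=
  lTensor A (lTensor A (mhat m ∘ₗ flipT K A)) ∘ₗ
    (TensorProduct.assoc K A A (A ⊗[K] A)).toLinearMap ∘ₗ ttc K A

/-- `r` is a solution of the S-equation in the pre-Lie algebra `(A, m)`. -/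
def IsSEq (m : A →ₗ[K] A →ₗ[K] A) (r : A ⊗[K] A) : Prop :=
  sTerm1 m (r ⊗ₜ[K] r) + sTerm2 m (r ⊗ₜ[K] r)
    = sTerm3 m (r ⊗ₜ[K] r) + sTerm4 m (r ⊗ₜ[K] r)

/-- The comultiplication `Δ_r(x) = x∘aᵢ ⊗ bᵢ + aᵢ ⊗ x∘bᵢ − aᵢ ⊗ bᵢ∘x`. -/
def coprodR (m : A →ₗ[K] A →ₗ[K] A) (r : A ⊗[K] A) : A →ₗ[K] A ⊗[K] A :=
  (rTensorHom (M := A) ∘ₗ m).flip r + (lTensorHom (M := A) ∘ₗ m).flip r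
    - (lTensorHom (M := A) ∘ₗ m.flip).flip r

/-- The Nijenhuis pre-Lie algebra `((A, m), N)` is `S`-admissible. -/
def IsAdmissible (m : A →ₗ[K] A →ₗ[K] A) (N S : A →ₗ[K] A) : Prop :=
  (∀ x y : A, S (m (N x) y) + m x (S (S y)) = m (N x) (S y) + S (m x (S y))) ∧
  (∀ x y : A, S (m x (N y)) + m (S (S x)) y = m (S x) (N y) + S (m (S x) y))

/-- `((A*, Δ*), S*)` is `N*`-admissible, written on `A`. -/
def IsCoAdmissible (Δ : A →ₗ[K] A ⊗[K] A) (N S : A →ₗ[K] A) : Prop :=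
  (∀ x : A, lTensor A S (Δ (N x)) + rTensor A (N ∘ₗ N) (Δ x)
      = TensorProduct.map N S (Δ x) + rTensor A N (Δ (N x))) ∧
  (∀ x : A, rTensor A S (Δ (N x)) + lTensor A (N ∘ₗ N) (Δ x)
      = TensorProduct.map S N (Δ x) + lTensor A N (Δ (N x)))

/-- `(A, m, Δ, N, S)` is a Nijenhuis pre-Lie bialgebra. -/
def IsNijPreLieBialg (m : A →ₗ[K] A →ₗ[K] A) (Δ : A →ₗ[K] A ⊗[K] A)
    (N S : A →ₗ[K] A) : Prop :=
  IsPreLie m ∧ IsNijenhuis m N ∧ IsPreLieCo Δ ∧ IsNijenhuisCo Δ S ∧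
    BialgEq1 m Δ ∧ BialgEq2 m Δ ∧ IsAdmissible m N S ∧ IsCoAdmissible Δ N S

/-- The pre-Lie bialgebra `(A, m, Δ)` is balanced. -/
def IsBalanced (m : A →ₗ[K] A →ₗ[K] A) (Δ : A →ₗ[K] A ⊗[K] A) : Prop :=
  ∀ x y : A, rTensor A (m.flip y) (Δ x) + flipT K A (rTensor A (m.flip x) (Δ y))
    = rTensor A (m.flip x) (Δ y) + flipT K A (rTensor A (m.flip y) (Δ x))

/-- `(A, b)` is a Lie algebra. -/
def IsLieBracket (b : A →ₗ[K] A →ₗ[K] A) : Prop :=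
  (∀ x : A, b x x = 0) ∧
  (∀ x y z : A, b (b x y) z + b (b y z) x + b (b z x) y = 0)

/-- `(A, d)` is a Lie coalgebra. -/
def IsLieCobracket (d : A →ₗ[K] A ⊗[K] A) : Prop :=
  (∀ x : A, d x = - flipT K A (d x)) ∧
  (∀ x : A, coassoc2 d d x + cyc K A (coassoc2 d d x) + cyc K A (cyc K A (coassoc2 d d x)) = 0)

/-- `(A, b, d)` is a Lie bialgebra. -/
def IsLieBialg (b : A →ₗ[K] A →ₗ[K] A) (d : A →ₗ[K] A ⊗[K] A) : Prop :=
  IsLieBracket b ∧ IsLieCobracket d ∧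
    ∀ x y : A, d (b x y)
      = rTensor A (b x) (d y) + lTensor A (b x) (d y)
        - rTensor A (b y) (d x) - lTensor A (b y) (d x)

/-- `(A, b, d, N, S)` is a Nijenhuis Lie bialgebra. -/
def IsNijLieBialg (b : A →ₗ[K] A →ₗ[K] A) (d : A →ₗ[K] A ⊗[K] A)
    (N S : A →ₗ[K] A) : Prop :=
  IsLieBialg b d ∧ IsNijenhuis b N ∧ IsNijenhuisCo d S ∧
  (∀ x y : A, S (b (N x) y) + b x (S (S y)) = b (N x) (S y) + S (b x (S y))) ∧
  (∀ x : A, rTensor A S (d (N x)) + lTensor A (N ∘ₗ N) (d x)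
      = TensorProduct.map S N (d x) + lTensor A N (d (N x)))

/-- The map `r♯ : A* → A`, `r♯(f) = Σ f(aᵢ) bᵢ`. -/
def rsharp (r : A ⊗[K] A) (f : A →ₗ[K] K) : A :=
  TensorProduct.lift (LinearMap.lsmul K A ∘ₗ f) r

/-- The map `N : A → A`, `N(x) = Σ ω(x, aᵢ) bᵢ`. -/
def hessNij (ω : A →ₗ[K] A →ₗ[K] K) (r : A ⊗[K] A) : A →ₗ[K] A :=
  TensorProduct.lift (LinearMap.smulRightₗ ∘ₗ ω.flip) r

/-- The map `S : A → A`, `S(x) = Σ aᵢ ω(bᵢ, x)`. -/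
def coNij (ω : A →ₗ[K] A →ₗ[K] K) (r : A ⊗[K] A) : A →ₗ[K] A :=
  TensorProduct.lift ((LinearMap.smulRightₗ ∘ₗ ω).flip) r

end Defs

section Rep

variable {K A V H : Type*} [Field K] [AddCommGroup A] [Module K A]
  [AddCommGroup V] [Module K V] [AddCommGroup H] [Module K H]

/-- `(V, ρ, φ)` is a representation of the pre-Lie algebra `(A, m)`. -/
def IsRep (m : A →ₗ[K] A →ₗ[K] A) (ρ φ : A →ₗ[K] V →ₗ[K] V) : Prop :=
  (∀ (x y : A) (v : V), ρ (m x y - m y x) v = ρ x (ρ y v) - ρ y (ρ x v)) ∧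
  (∀ (x y : A) (v : V), φ (m x y) v = ρ x (φ y v) - φ y (ρ x v) + φ y (φ x v))

/-- The `α`-conditions making `((V, ρ, φ), α)` a representation of `((A, m), N)`. -/
def IsNijRep (m : A →ₗ[K] A →ₗ[K] A) (N : A →ₗ[K] A) (ρ φ : A →ₗ[K] V →ₗ[K] V)
    (α : V →ₗ[K] V) : Prop :=
  (∀ (x : A) (v : V), ρ (N x) (α v) + α (α (ρ x v)) = α (ρ (N x) v) + α (ρ x (α v))) ∧
  (∀ (x : A) (v : V), φ (N x) (α v) + α (α (φ x v)) = α (φ (N x) v) + α (φ x (α v)))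

/-- The semidirect product multiplication on `A ⊕ V`:
`(x+u) ∘ (y+v) = x∘y + ρ(x)v + φ(y)u`. -/
def semidirectMul (m : A →ₗ[K] A →ₗ[K] A) (ρ φ : A →ₗ[K] V →ₗ[K] V) :
    (A × V) →ₗ[K] (A × V) →ₗ[K] (A × V) :=
  (m.compl₁₂ (fst K A V) (fst K A V)).compr₂ (inl K A V)
  + (ρ.compl₁₂ (fst K A V) (snd K A V)).compr₂ (inr K A V)
  + ((φ.compl₁₂ (fst K A V) (snd K A V)).compr₂ (inr K A V)).flip

/-- The bicrossed product multiplication on `A ⊕ H`: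
`(x+a) ∘ (y+b) = x∘y + ρ_H(a)y + φ_H(b)x + a∘b + ρ_A(x)b + φ_A(y)a`. -/
def matchedMul (mA : A →ₗ[K] A →ₗ[K] A) (mH : H →ₗ[K] H →ₗ[K] H)
    (ρA φA : A →ₗ[K] H →ₗ[K] H) (ρH φH : H →ₗ[K] A →ₗ[K] A) :
    (A × H) →ₗ[K] (A × H) →ₗ[K] (A × H) :=
  (mA.compl₁₂ (fst K A H) (fst K A H)).compr₂ (inl K A H)
  + (ρH.compl₁₂ (snd K A H) (fst K A H)).compr₂ (inl K A H)
  + ((φH.compl₁₂ (snd K A H) (fst K A H)).compr₂ (inl K A H)).flip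
  + (mH.compl₁₂ (snd K A H) (snd K A H)).compr₂ (inr K A H)
  + (ρA.compl₁₂ (fst K A H) (snd K A H)).compr₂ (inr K A H)
  + ((φA.compl₁₂ (fst K A H) (snd K A H)).compr₂ (inr K A H)).flip

/-- Equations (3.5)–(3.8) of a matched pair of pre-Lie algebras. -/
def MatchedPairEqs (mA : A →ₗ[K] A →ₗ[K] A) (mH : H →ₗ[K] H →ₗ[K] H)
    (ρA φA : A →ₗ[K] H →ₗ[K] H) (ρH φH : H →ₗ[K] A →ₗ[K] A) : Prop :=
  (∀ (x : A) (a b : H), ρA x (mH a b)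
      = -(ρA (ρH a x - φH a x) b) + mH (ρA x a - φA x a) b + φA (φH b x) a + mH a (ρA x b)) ∧
  (∀ (x : A) (a b : H), φA x (mH a b - mH b a)
      = φA (ρH b x) a - φA (ρH a x) b + mH a (φA x b) - mH b (φA x a)) ∧
  (∀ (a : H) (x y : A), ρH a (mA x y)
      = -(ρH (ρA x a - φA x a) y) + mA (ρH a x - φH a x) y + φH (φA y a) x + mA x (ρH a y)) ∧
  (∀ (a : H) (x y : A), φH a (mA x y - mA y x)
      = φH (ρA y a) x - φH (ρA x a) y + mA x (φH a y) - mA y (φH a x))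

/-- The (negative) dual action `x ↦ ρ*(x)`, `⟨ρ*(x)v*, v⟩ = −⟨v*, ρ(x)v⟩`. -/
def negTranspose (ρ : A →ₗ[K] V →ₗ[K] V) :
    A →ₗ[K] (V →ₗ[K] K) →ₗ[K] (V →ₗ[K] K) :=
  Module.Dual.transpose (R := K) ∘ₗ (-ρ)

end Rep

set_option synthInstance.maxHeartbeats 1000000
set_option maxHeartbeats 1000000

section Theorems

variable {K A V H : Type*} [Field K] [AddCommGroup A] [Module K A]
  [AddCommGroup V] [Module K V] [AddCommGroup H] [Module K H]

def T3 (f g h : A →ₗ[K] K) : A ⊗[K] (A ⊗[K] A) →ₗ[K] K :=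
  LinearMap.mul' K K ∘ₗ TensorProduct.map f (pairForm g h)

def RL (r : A ⊗[K] A) (f : A →ₗ[K] K) : A := TensorProduct.lid K A (rTensor A f r)
def RR (r : A ⊗[K] A) (f : A →ₗ[K] K) : A := TensorProduct.rid K A (lTensor A f r)

theorem pairForm_tmul (f g : A →ₗ[K] K) (x y : A) : pairForm f g (x ⊗ₜ[K] y) = f x * g y := by
  simp [pairForm]

theorem T3_tmul (f g h : A →ₗ[K] K) (x y z : A) :
    T3 f g h (x ⊗ₜ[K] (y ⊗ₜ[K] z)) = f x * (g y * h z) := by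
  simp [T3, pairForm_tmul]

theorem T3_tmul' (f g h : A →ₗ[K] K) (x : A) (t : A ⊗[K] A) :
    T3 f g h (x ⊗ₜ[K] t) = f x * pairForm g h t := by
  simp [T3]

theorem T3_assoc (f g h : A →ₗ[K] K) (z : A) (t : A ⊗[K] A) :
    T3 f g h (TensorProduct.assoc K A A A (t ⊗ₜ[K] z)) = pairForm f g t * h z := by
  induction t using TensorProduct.induction_on with
  | zero => simp
  | tmul x y => simp [T3_tmul, pairForm_tmul, mul_assoc]
  | add a b ha hb => simp only [TensorProduct.add_tmul, map_add, ha, hb, add_mul]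

theorem T3_swap (f g h : A →ₗ[K] K) (t : A ⊗[K] (A ⊗[K] A)) :
    T3 f g h (swap12 K A t) = T3 g f h t := by
  have : T3 f g h ∘ₗ swap12 K A = T3 g f h := by
    ext x y z
    simp [swap12, flipT, T3_tmul]
    ring
  exact LinearMap.congr_fun this t

theorem RL_tmul (f : A →ₗ[K] K) (x y : A) : RL (x ⊗ₜ[K] y) f = f x • y := by simp [RL]
theorem RR_tmul (f : A →ₗ[K] K) (x y : A) : RR (x ⊗ₜ[K] y) f = f y • x := by simp [RR]
theorem RL_add (f : A →ₗ[K] K) (x y : A ⊗[K] A) : RL (x + y) f = RL x f + RL y f := by simp [RL]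
theorem RR_add (f : A →ₗ[K] K) (x y : A ⊗[K] A) : RR (x + y) f = RR x f + RR y f := by simp [RR]
theorem RL_zero (f : A →ₗ[K] K) : RL (0 : A ⊗[K] A) f = 0 := by simp [RL]
theorem RR_zero (f : A →ₗ[K] K) : RR (0 : A ⊗[K] A) f = 0 := by simp [RR]

theorem RL_flip (r : A ⊗[K] A) (f : A →ₗ[K] K) : RL (flipT K A r) f = RR r f := by
  induction r using TensorProduct.induction_on with
  | zero => simp [RL_zero, RR_zero]
  | tmul x y => simp [flipT, RL_tmul, RR_tmul]
  | add a b ha hb => simp only [map_add, RL_add, RR_add, ha, hb]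

theorem RL_RR (r : A ⊗[K] A) (f g : A →ₗ[K] K) : f (RR r g) = g (RL r f) := by
  induction r using TensorProduct.induction_on with
  | zero => simp [RL_zero, RR_zero]
  | tmul x y => simp [RL_tmul, RR_tmul, mul_comm]
  | add a b ha hb => simp only [map_add, RL_add, RR_add, ha, hb]

theorem coNij_eq (ω : A →ₗ[K] A →ₗ[K] K) (r : A ⊗[K] A) (f : A →ₗ[K] K) (x : A) :
    f (coNij ω r x) = ω (RL r f) x := by
  induction r using TensorProduct.induction_on with
  | zero => simp [RL_zero, coNij]
  | tmul a b => simp [RL_tmul, coNij, mul_comm]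
  | add a b ha hb =>
    simp only [coNij, map_add, RL_add, LinearMap.add_apply] at ha hb ⊢
    rw [ha, hb]

theorem T3_assocΔ (Δ : A →ₗ[K] A ⊗[K] A) (r : A ⊗[K] A) (f g h : A →ₗ[K] K) :
    T3 f g h ((TensorProduct.assoc K A A A) (rTensor A Δ r)) = pairForm f g (Δ (RR r h)) := by
  induction r using TensorProduct.induction_on with
  | zero => simp [RR_zero]
  | tmul a b => simp only [rTensor_tmul, T3_assoc, RR_tmul, map_smul, smul_eq_mul, mul_comm]
  | add a b ha hb => simp only [map_add, RR_add, ha, hb]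

theorem T3_lΔ (Δ : A →ₗ[K] A ⊗[K] A) (r : A ⊗[K] A) (f g h : A →ₗ[K] K) :
    T3 f g h (lTensor A Δ r) = pairForm g h (Δ (RL r f)) := by
  induction r using TensorProduct.induction_on with
  | zero => simp [RL_zero]
  | tmul a b => simp only [lTensor_tmul, T3_tmul', RL_tmul, map_smul, smul_eq_mul]
  | add a b ha hb => simp only [map_add, RL_add, ha, hb]

theorem T3_s1 (m : A →ₗ[K] A →ₗ[K] A) (r s : A ⊗[K] A) (f g h : A →ₗ[K] K) :
    T3 f g h (sTerm1 m (r ⊗ₜ[K] s)) = g (m (RL r f) (RR s h)) := by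
  induction r using TensorProduct.induction_on with
  | zero => simp [RL_zero]
  | add a b ha hb => simp only [TensorProduct.add_tmul, map_add, RL_add, ha, hb, LinearMap.add_apply]
  | tmul a b =>
    induction s using TensorProduct.induction_on with
    | zero => simp [RR_zero]
    | add a b ha hb => simp only [TensorProduct.tmul_add, map_add, RR_add, ha, hb]
    | tmul c d => simp [sTerm1, mhat, T3_tmul, RL_tmul, RR_tmul]; ring

theorem T3_s2 (m : A →ₗ[K] A →ₗ[K] A) (r s : A ⊗[K] A) (f g h : A →ₗ[K] K) :
    T3 f g h (sTerm2 m (r ⊗ₜ[K] s)) = h (m (RL r f) (RL s g)) := by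
  induction r using TensorProduct.induction_on with
  | zero => simp [RL_zero]
  | add a b ha hb => simp only [TensorProduct.add_tmul, map_add, RL_add, ha, hb, LinearMap.add_apply]
  | tmul a b =>
    induction s using TensorProduct.induction_on with
    | zero => simp [RL_zero]
    | add a b ha hb => simp only [TensorProduct.tmul_add, map_add, RL_add, ha, hb]
    | tmul c d => simp [sTerm2, swap12, flipT, mhat, T3_tmul, RL_tmul]; ring

theorem T3_s3 (m : A →ₗ[K] A →ₗ[K] A) (r s : A ⊗[K] A) (f g h : A →ₗ[K] K) :
    T3 f g h (sTerm3 m (r ⊗ₜ[K] s)) = f (m (RR r g) (RR s h)) := by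
  induction r using TensorProduct.induction_on with
  | zero => simp [RR_zero]
  | add a b ha hb => simp only [TensorProduct.add_tmul, map_add, RR_add, ha, hb, LinearMap.add_apply]
  | tmul a b =>
    induction s using TensorProduct.induction_on with
    | zero => simp [RR_zero]
    | add a b ha hb => simp only [TensorProduct.tmul_add, map_add, RR_add, ha, hb]
    | tmul c d => simp [sTerm3, ttc, mhat, T3_tmul, RR_tmul]; ring

theorem T3_s4 (m : A →ₗ[K] A →ₗ[K] A) (r s : A ⊗[K] A) (f g h : A →ₗ[K] K) :
    T3 f g h (sTerm4 m (r ⊗ₜ[K] s)) = h (m (RL s g) (RL r f)) := by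
  induction r using TensorProduct.induction_on with
  | zero => simp [RL_zero]
  | add a b ha hb => simp only [TensorProduct.add_tmul, map_add, RL_add, ha, hb]
  | tmul a b =>
    induction s using TensorProduct.induction_on with
    | zero => simp [RL_zero]
    | add a b ha hb =>
      simp only [TensorProduct.tmul_add, map_add, RL_add, ha, hb, LinearMap.add_apply]
    | tmul c d => simp [sTerm4, ttc, flipT, mhat, T3_tmul, RL_tmul]

theorem lift1 (ω : A →ₗ[K] A →ₗ[K] K) (h : A →ₗ[K] K) (y : A) (t : A ⊗[K] A) :
    h (TensorProduct.lift ((LinearMap.smulRightₗ ∘ₗ ω).flip) t y) = pairForm h (ω.flip y) t := by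
  induction t using TensorProduct.induction_on with
  | zero => simp
  | tmul a b => simp [pairForm_tmul, mul_comm]
  | add a b ha hb => simp only [map_add, LinearMap.add_apply, ha, hb]

theorem lift2 (ω : A →ₗ[K] A →ₗ[K] K) (h : A →ₗ[K] K) (y : A) (t : A ⊗[K] A) :
    h (TensorProduct.lift (LinearMap.smulRightₗ ∘ₗ ω) t y) = pairForm (ω.flip y) h t := by
  induction t using TensorProduct.induction_on with
  | zero => simp
  | tmul a b => simp [pairForm_tmul]
  | add a b ha hb => simp only [map_add, LinearMap.add_apply, ha, hb]

theorem omul_apply (Δ : A →ₗ[K] A ⊗[K] A) (ω : A →ₗ[K] A →ₗ[K] K) (h : A →ₗ[K] K) (x y : A) :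
    h (omul Δ ω x y) = pairForm h (ω.flip y) (Δ x) + pairForm h (ω x) (Δ y)
      - pairForm (ω x) h (Δ y) := by
  simp only [omul, LinearMap.sub_apply, LinearMap.add_apply, map_sub, map_add,
    LinearMap.flip_apply, LinearMap.comp_apply, lift1, lift2]
  rfl

theorem pairForm_map (f g : A →ₗ[K] K) (S U : A →ₗ[K] A) (t : A ⊗[K] A) :
    pairForm f g (TensorProduct.map S U t) = pairForm (f ∘ₗ S) (g ∘ₗ U) t := by
  induction t using TensorProduct.induction_on with
  | zero => simp
  | tmul a b => simp [pairForm_tmul]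
  | add a b ha hb => simp only [map_add, ha, hb]

theorem pairForm_sep (s t : A ⊗[K] A) (h : ∀ f g : A →ₗ[K] K, pairForm f g s = pairForm f g t) :
    s = t := by
  let b := Module.Free.chooseBasis K A
  have key : ∀ (u : A ⊗[K] A) i j, (b.tensorProduct b).repr u (i, j)
      = pairForm (b.coord i) (b.coord j) u := by
    intro u i j
    induction u using TensorProduct.induction_on with
    | zero => simp
    | tmul x y => simp [pairForm_tmul, mul_comm]
    | add x y hx hy => simp only [map_add, Finsupp.add_apply, hx, hy]
  apply (b.tensorProduct b).ext_elem
  rintro ⟨i, j⟩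
  rw [key, key, h]

theorem nijenhuis_coalgebra_from_pseudoHessian
    (Δ : A →ₗ[K] A ⊗[K] A) (hΔ : IsPreLieCo Δ)
    (r : A ⊗[K] A) (hr : flipT K A r = r)
    (hpH : (TensorProduct.assoc K A A A) (rTensor A Δ r) - lTensor A Δ r
        = swap12 K A ((TensorProduct.assoc K A A A) (rTensor A Δ r))
          - swap12 K A (lTensor A Δ r))
    (ω : A →ₗ[K] A →ₗ[K] K) (hsym : ∀ x y : A, ω x y = ω y x) (hω : IsCoSEq Δ ω)
    (hSeq : IsSEq (omul Δ ω) r) :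
    IsNijenhuisCo Δ (coNij ω r) := by
  have hflip : ω.flip = ω := by ext x y; exact hsym y x
  have hRR : ∀ f, RR r f = RL r f := fun f => by rw [← RL_flip, hr]
  have hRs : ∀ f g : A →ₗ[K] K, f (RL r g) = g (RL r f) := fun f g => by rw [← RL_RR, hRR]
  -- product on the dual, and the transpose of `S`
  let p : (A →ₗ[K] K) → (A →ₗ[K] K) → (A →ₗ[K] K) := fun f g => pairForm f g ∘ₗ Δ
  let R : (A →ₗ[K] K) → A := RL r
  let N : (A →ₗ[K] K) → (A →ₗ[K] K) := fun f => ω (R f)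
  have hN : ∀ f, f ∘ₗ coNij ω r = N f := fun f => LinearMap.ext fun x => coNij_eq ω r f x
  have hcoS : ∀ x y z, p (ω x) (ω z) y + p (ω x) (ω y) z = p (ω y) (ω z) x + p (ω y) (ω x) z := by
    intro x y z
    have := hω x y z
    rw [hflip] at this
    exact this
  have hom : ∀ (h : A →ₗ[K] K) x y, h (omul Δ ω x y) = p h (ω y) x + p h (ω x) y - p (ω x) h y := by
    intro h x y
    rw [omul_apply, hflip]; rfl
  have hess : ∀ f g h, p f g (R h) - p g h (R f) = p g f (R h) - p f h (R g) := by
    intro f g h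
    have := congrArg (T3 f g h) hpH
    simp only [map_sub, T3_swap, T3_assocΔ, T3_lΔ, hRR] at this
    exact this
  have hS : ∀ f g h : A →ₗ[K] K, g (omul Δ ω (R f) (R h)) + h (omul Δ ω (R f) (R g))
      = f (omul Δ ω (R g) (R h)) + h (omul Δ ω (R g) (R f)) := by
    intro f g h
    have := congrArg (T3 f g h) hSeq
    simp only [map_add, T3_s1, T3_s2, T3_s3, T3_s4, hRR] at this
    exact this
  let q : (A →ₗ[K] K) → (A →ₗ[K] K) → (A →ₗ[K] K) → K := fun f g h => p f g (R (N h))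
  have hNR : ∀ f g : A →ₗ[K] K, N f (R g) = f (R (N g)) := by
    intro f g
    change ω (R f) (R g) = f (RL r (N g))
    rw [hRs f]
    exact hsym _ _
  have hq : ∀ f g h, N h (R (p f g)) = q f g h := fun f g h => hRs _ _
  have hom' : ∀ f g h : A →ₗ[K] K, h (omul Δ ω (R f) (R g)) =
      p f (N g) (R h) + p (N f) g (R h) + q f h g - q h f g - q h g f := by
    intro f g h
    rw [hom]
    change p h (N g) (R f) + p h (N f) (R g) - p (N f) h (R g) = _
    have h1 : p (N f) h (R g) - q h g f = _ := hess (N f) h g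
    have h2 := hess f h (N g)
    change q f h g - _ = q h f g - _ at h2
    linear_combination -h1 - h2
  have hD : ∀ f g h, q f g h - q g h f = q g f h - q f h g := by
    intro f g h
    have s := hS f g h
    rw [hom', hom', hom', hom'] at s
    have a := hess (N f) g h
    have b := hess f (N g) h
    have c := hess f g (N h)
    change _ - q g h f = _ at a
    change _ = _ - q f h g at b
    change q f g h - _ = q g f h - _ at c
    linear_combination s - a - b - c
  have hfin : ∀ f g, p (N f) (N g) = N (p (N f) g) + N (p f (N g)) - N (N (p f g)) := by
    intro f g
    ext z
    have h1 := hcoS (R f) z (R g)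
    have h2 := hom (ω z) (R f) (R g)
    have h3 := hom' f g (ω z)
    have h4 := hD f (ω z) g
    have e1 : ∀ u : A →ₗ[K] K, N u z = u (R (ω z)) := by
      intro u
      change ω (RL r u) z = u (RL r (ω z))
      rw [hRs, hsym]
    simp only [LinearMap.sub_apply, LinearMap.add_apply, e1, hNR]
    change _ = _ + _ - q f g (ω z)
    change p (ω (R f)) (ω (R g)) z = _
    linear_combination h1 - h2 + h3 + h4
  intro x
  apply pairForm_sep
  intro f g
  have := LinearMap.congr_fun (hfin f g) x
  rw [LinearMap.sub_apply, LinearMap.add_apply] at this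
  have e : ∀ (u : A →ₗ[K] K) x, u (coNij ω r x) = N u x := fun u x => coNij_eq ω r u x
  have e2 : ∀ (u v : A →ₗ[K] K) x, pairForm u v (Δ x) = p u v x := fun _ _ _ => rfl
  have e3 : ∀ (u v : A →ₗ[K] K) x, p u v (coNij ω r x) = N (p u v) x := fun u v x => e _ _
  simp only [map_add, rTensor, lTensor, pairForm_map, hN, LinearMap.comp_id, e2, e3]
  rw [this, ← hN (p f g), ← hN]
  simp only [LinearMap.comp_apply, e]
  ring

end Theorems
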